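/- arXiv:2512.10601 — 7 statements merged into one kernel-verified Lean document; each statement's English description precedes it below -/
import Mathlib

section
/- Let (S,A,P,r) be a finite Markov decision process, let π and π' be stationary policies, let d' be a stationary distribution for π', and let (J, V̄) be a solution of the average-reward Poisson equation for π with respect to r, with associated advantage function Ā. Define the average reward of π' by J(π') = Σ_{s,a,s'} d'(s) π'(a|s) P(s'|s,a) r(s,a,s'). Then Σ_s d'(s) Σ_a π'(a|s) Ā(s,a) = J(π') − J. -/
/-- **Average-reward policy difference lemma.**
For a finite MDP, a policy `pol'` with stationary distribution `d'`, and a solution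
`(J, V)` of the average-reward Poisson equation for `pol` with advantage `Adv`, the
`d'`-weighted expected advantage equals `J(π') − J`. -/
theorem stmt_0
    {S A : Type*} [Fintype S] [Fintype A]
    (P : S → A → S → ℝ) (r : S → A → S → ℝ)
    (pol pol' : S → A → ℝ) (d' : S → ℝ)
    (J : ℝ) (V : S → ℝ) (Q Adv : S → A → ℝ)
    (hP_nonneg : ∀ s a s', 0 ≤ P s a s')
    (hP_sum : ∀ s a, ∑ s', P s a s' = 1)
    (hpol_nonneg : ∀ s a, 0 ≤ pol s a)
    (hpol_sum : ∀ s, ∑ a, pol s a = 1)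
    (hpol'_nonneg : ∀ s a, 0 ≤ pol' s a)
    (hpol'_sum : ∀ s, ∑ a, pol' s a = 1)
    (hd'_nonneg : ∀ s, 0 ≤ d' s)
    (hd'_sum : ∑ s, d' s = 1)
    (hd'_stat : ∀ s', ∑ s, d' s * ∑ a, pol' s a * P s a s' = d' s')
    (hQ : ∀ s a, Q s a = ∑ s', P s a s' * (r s a s' - J + V s'))
    (hPoisson : ∀ s, V s = ∑ a, pol s a * Q s a)
    (hAdv : ∀ s a, Adv s a = Q s a - V s) :
    ∑ s, d' s * ∑ a, pol' s a * Adv s a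
      = (∑ s, ∑ a, ∑ s', d' s * pol' s a * P s a s' * r s a s') - J := by
  have adv_eq : ∀ s a, Adv s a
      = (∑ s', P s a s' * r s a s') + (∑ s', P s a s' * V s') - (J + V s) := by
    intro s a
    have hJ : ∑ s', P s a s' * J = J := by rw [← Finset.sum_mul, hP_sum, one_mul]
    simp only [hAdv, hQ, mul_add, mul_sub, Finset.sum_add_distrib, Finset.sum_sub_distrib, hJ]
    ring
  have expected_adv : ∀ s, ∑ a, pol' s a * Adv s a
      = (∑ a, pol' s a * ∑ s', P s a s' * r s a s')
        + (∑ a, pol' s a * ∑ s', P s a s' * V s') - (J + V s) := by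
    intro s
    simp only [adv_eq, mul_sub, mul_add (pol' s _) (∑ s', _) (∑ s', _),
      Finset.sum_add_distrib, Finset.sum_sub_distrib]
    rw [← Finset.sum_mul, hpol'_sum, one_mul]
  have stationary_V : ∑ s, d' s * ∑ a, pol' s a * ∑ s', P s a s' * V s'
      = ∑ s, d' s * V s := by
    calc ∑ s, d' s * ∑ a, pol' s a * ∑ s', P s a s' * V s'
        = ∑ s, ∑ s', d' s * (∑ a, pol' s a * P s a s') * V s' := by
          refine Finset.sum_congr rfl fun s _ => ?_
          simp only [Finset.mul_sum, Finset.sum_mul, mul_assoc]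
          exact Finset.sum_comm
      _ = ∑ s', (∑ s, d' s * ∑ a, pol' s a * P s a s') * V s' := by
          rw [Finset.sum_comm]
          simp only [Finset.sum_mul]
      _ = ∑ s, d' s * V s := by simp only [hd'_stat]
  have sum_J : ∑ s, d' s * J = J := by rw [← Finset.sum_mul, hd'_sum, one_mul]
  have reward_eq : ∑ s, d' s * ∑ a, pol' s a * ∑ s', P s a s' * r s a s'
      = ∑ s, ∑ a, ∑ s', d' s * pol' s a * P s a s' * r s a s' := by
    simp only [Finset.mul_sum, mul_assoc]
  rw [← reward_eq]
  simp only [expected_adv, mul_sub (d' _), mul_add (d' _), Finset.sum_add_distrib,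
    Finset.sum_sub_distrib, stationary_V, sum_J]
  ring
end

section
/- Let (S,A,P,r) be a finite Markov decision process, let π and π' be stationary policies, let d' be a stationary distribution for π', let (J, V̄) solve the average-reward Poisson equation for π with respect to r with advantage Ā, and let d be any probability distribution on S. Set J(π') = Σ_{s,a,s'} d'(s) π'(a|s) P(s'|s,a) r(s,a,s') and ε = max_{s∈S} |Σ_a π'(a|s) Ā(s,a)|. Then |J(π') − J − Σ_s d(s) Σ_a π'(a|s) Ā(s,a)| ≤ 2 ε · TV(d'‖d). -/
/-- A weighted sum against a difference of weights is bounded by the maximum of the absolute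
values times the `ℓ¹` distance of the weights. -/
theorem abs_sum_mul_sub_sum_mul_le {S : Type*} [Fintype S] [Nonempty S] (p q f : S → ℝ) :
    |∑ s, p s * f s - ∑ s, q s * f s|
      ≤ (Finset.univ.sup' Finset.univ_nonempty fun s => |f s|) * ∑ s, |p s - q s| := by
  rw [← Finset.sum_sub_distrib, Finset.mul_sum]
  refine (Finset.abs_sum_le_sum_abs _ _).trans (Finset.sum_le_sum fun s _ => ?_)
  rw [← sub_mul, abs_mul, mul_comm]
  exact mul_le_mul_of_nonneg_right
    (Finset.le_sup' (fun s => |f s|) (Finset.mem_univ s)) (abs_nonneg _)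

/-- The expected one-step temporal difference in a state, with the reward, the gain and the value
function separated. -/
theorem sum_policy_mul_advantage {S A : Type*} [Fintype S] [Fintype A]
    (P r : A → S → ℝ) (p : A → ℝ) (J v : ℝ) (V : S → ℝ)
    (hP : ∀ a, ∑ s', P a s' = 1) (hp : ∑ a, p a = 1) :
    ∑ a, p a * (∑ s', P a s' * (r a s' - J + V s') - v)
      = ∑ a, ∑ s', p a * P a s' * r a s' - J + ∑ s', (∑ a, p a * P a s') * V s' - v := by
  have hQ : ∀ a, p a * (∑ s', P a s' * (r a s' - J + V s') - v)
      = ∑ s', p a * P a s' * r a s' - p a * J + ∑ s', p a * P a s' * V s' - p a * v := by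
    intro a
    have h : ∑ s', P a s' * (r a s' - J + V s')
        = ∑ s', P a s' * r a s' - J + ∑ s', P a s' * V s' := by
      simp only [mul_add, mul_sub, Finset.sum_add_distrib, Finset.sum_sub_distrib,
        ← Finset.sum_mul, hP a, one_mul]
    rw [h]
    simp only [mul_assoc, ← Finset.mul_sum]
    ring
  simp only [hQ, Finset.sum_add_distrib, Finset.sum_sub_distrib]
  rw [← Finset.sum_mul, ← Finset.sum_mul, hp, one_mul, one_mul, Finset.sum_comm (γ := A)
    (f := fun a s' => p a * P a s' * V s')]
  simp only [Finset.sum_mul]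

/-- **Average-reward performance difference.** Under a stationary distribution `d` of the policy
`pol`, the expected advantage is the average reward of `pol` minus the gain `J`. -/
theorem sum_stationary_mul_advantage {S A : Type*} [Fintype S] [Fintype A]
    (P r : S → A → S → ℝ) (pol : S → A → ℝ) (d : S → ℝ) (J : ℝ) (V : S → ℝ)
    (hP : ∀ s a, ∑ s', P s a s' = 1) (hpol : ∀ s, ∑ a, pol s a = 1) (hd : ∑ s, d s = 1)
    (hstat : ∀ s', ∑ s, d s * ∑ a, pol s a * P s a s' = d s') :
    ∑ s, d s * ∑ a, pol s a * (∑ s', P s a s' * (r s a s' - J + V s') - V s)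
      = (∑ s, ∑ a, ∑ s', d s * pol s a * P s a s' * r s a s') - J := by
  have hV : ∑ s, d s * ∑ s', (∑ a, pol s a * P s a s') * V s' = ∑ s, d s * V s := by
    simp only [Finset.mul_sum (s := Finset.univ (α := S)), ← mul_assoc]
    rw [Finset.sum_comm]
    simp only [← Finset.sum_mul, hstat]
  simp only [fun s => sum_policy_mul_advantage (P s) (r s) (pol s) J (V s) V (hP s) (hpol s)]
  simp only [mul_sub, mul_add, Finset.sum_add_distrib, Finset.sum_sub_distrib, hV]
  rw [← Finset.sum_mul, hd]
  simp only [Finset.mul_sum, mul_assoc]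
  ring

/-- **Average-reward surrogate approximation bound.**
The error of approximating `J(π') − J` by the `d`-weighted expected advantage is at most
`2 ε · TV(d'‖d)`, where `ε = max_s |Σ_a π'(a|s) Ā(s,a)|`. -/
theorem stmt_1
    {S A : Type*} [Fintype S] [Nonempty S] [Fintype A]
    (P : S → A → S → ℝ) (r : S → A → S → ℝ)
    (pol pol' : S → A → ℝ) (d d' : S → ℝ)
    (J : ℝ) (V : S → ℝ) (Q Adv : S → A → ℝ)
    (hP_nonneg : ∀ s a s', 0 ≤ P s a s')
    (hP_sum : ∀ s a, ∑ s', P s a s' = 1)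
    (hpol_nonneg : ∀ s a, 0 ≤ pol s a)
    (hpol_sum : ∀ s, ∑ a, pol s a = 1)
    (hpol'_nonneg : ∀ s a, 0 ≤ pol' s a)
    (hpol'_sum : ∀ s, ∑ a, pol' s a = 1)
    (hd_nonneg : ∀ s, 0 ≤ d s)
    (hd_sum : ∑ s, d s = 1)
    (hd'_nonneg : ∀ s, 0 ≤ d' s)
    (hd'_sum : ∑ s, d' s = 1)
    (hd'_stat : ∀ s', ∑ s, d' s * ∑ a, pol' s a * P s a s' = d' s')
    (hQ : ∀ s a, Q s a = ∑ s', P s a s' * (r s a s' - J + V s'))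
    (hPoisson : ∀ s, V s = ∑ a, pol s a * Q s a)
    (hAdv : ∀ s a, Adv s a = Q s a - V s) :
    |(∑ s, ∑ a, ∑ s', d' s * pol' s a * P s a s' * r s a s') - J
        - ∑ s, d s * ∑ a, pol' s a * Adv s a|
      ≤ 2 * (Finset.univ.sup' Finset.univ_nonempty fun s => |∑ a, pol' s a * Adv s a|)
          * ((1 / 2) * ∑ s, |d' s - d s|) := by
  have hdiff := sum_stationary_mul_advantage P r pol' d' J V hP_sum hpol'_sum hd'_sum hd'_stat
  simp only [← hQ, ← hAdv] at hdiff
  rw [← hdiff]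
  refine (abs_sum_mul_sub_sum_mul_le d' d fun s => ∑ a, pol' s a * Adv s a).trans_eq ?_
  ring
end

section
/- Let (S,A,P) be a finite Markov decision process with reward r and cost functions C_1,…,C_m : S × A × S → ℝ and thresholds l_1,…,l_m ∈ ℝ. Let π and π' be stationary policies with stationary distributions d (for π) and d' (for π'). Let (J, V̄) solve the average-reward Poisson equation for π with respect to r with advantage Ā, and for each i let (J_{C_i}, V̄_{C_i}) solve it with respect to C_i with advantage Ā_{C_i}; write J(π') and J_{C_i}(π') for the average reward and average costs of π' computed under d'. Assume: (a) σ ≥ 0 satisfies TV(d'‖d) ≤ σ · Σ_s d(s) TV(π'(·|s)‖π(·|s)); (b) π'(·|s) is absolutely continuous with respect to π(·|s) for every s and Σ_s d(s) KL(π'(·|s)‖π(·|s)) ≤ δ + V_max for given δ, V_max ≥ 0; (c) π' is feasible for the trust-region subproblem at π, i.e. Σ_s d(s) Σ_a π'(a|s) Ā(s,a) ≥ 0 and J_{C_i} + Σ_s d(s) Σ_a π'(a|s) Ā_{C_i}(s,a) ≤ l_i for every i. Set ν = σ · max_s |Σ_a π'(a|s) Ā(s,a)| and ν_C = σ · max_{i∈[m],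 s∈S} |Σ_a π'(a|s) Ā_{C_i}(s,a)|. Then J(π') − J ≥ −√(2(δ + V_max)) · ν, and J_{C_i}(π') ≤ l_i + √(2(δ + V_max)) · ν_C for every i ∈ [m]. -/
open Finset

/-- A rational lower bound for the logarithm, tight to third order at `1`. -/
theorem Real.rational_le_log {t : ℝ} (ht : 0 < t) :
    (t - 1) * (5 * t + 1) / (2 * t * (t + 2)) ≤ Real.log t := by
  let F : ℝ → ℝ := fun x => Real.log x - (x - 1) * (5 * x + 1) / (2 * x * (x + 2))
  have hF : ∀ x : ℝ, 0 < x → HasDerivAt F ((x - 1) ^ 3 / (x ^ 2 * (x + 2) ^ 2)) x := by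
    intro x hx
    have hnum : HasDerivAt (fun y : ℝ => (y - 1) * (5 * y + 1))
        (1 * (5 * x + 1) + (x - 1) * (5 * 1)) x :=
      ((hasDerivAt_id' x).sub_const 1).mul (((hasDerivAt_id' x).const_mul 5).add_const 1)
    have hden : HasDerivAt (fun y : ℝ => 2 * y * (y + 2)) (2 * 1 * (x + 2) + 2 * x * 1) x :=
      ((hasDerivAt_id' x).const_mul 2).mul ((hasDerivAt_id' x).add_const 2)
    have hx2 : x + 2 ≠ 0 := by positivity
    have hderiv := (Real.hasDerivAt_log hx.ne').sub (hnum.div hden (by positivity))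
    refine hderiv.congr_deriv ?_
    field_simp
    ring
  have hF1 : F 1 = 0 := by simp [F]
  suffices h : F 1 ≤ F t by
    rw [hF1] at h
    exact sub_nonneg.mp h
  rcases le_total t 1 with h1 | h1
  · refine antitoneOn_of_hasDerivWithinAt_nonpos (convex_Icc t 1)
      (fun x hx => (hF x (ht.trans_le hx.1)).continuousAt.continuousWithinAt)
      (fun x hx => (hF x ?_).hasDerivWithinAt) (fun x hx => ?_)
      (Set.left_mem_Icc.mpr h1) (Set.right_mem_Icc.mpr h1) h1
    · exact ht.trans_le (interior_subset hx).1
    · have hx1 : x - 1 ≤ 0 := sub_nonpos.mpr (interior_subset hx).2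
      exact div_nonpos_of_nonpos_of_nonneg ((Odd.pow_nonpos_iff (by decide)).mpr hx1)
        (by positivity)
  · refine monotoneOn_of_hasDerivWithinAt_nonneg (convex_Icc 1 t)
      (fun x hx => (hF x (one_pos.trans_le hx.1)).continuousAt.continuousWithinAt)
      (fun x hx => (hF x ?_).hasDerivWithinAt) (fun x hx => ?_)
      (Set.left_mem_Icc.mpr h1) (Set.right_mem_Icc.mpr h1) h1
    · exact one_pos.trans_le (interior_subset hx).1
    · have hx1 : 0 ≤ x - 1 := sub_nonneg.mpr (interior_subset hx).1
      positivity

/-- The pointwise estimate behind Pinsker's inequality. -/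
theorem sq_sub_le_mul_log_div {p q : ℝ} (hp : 0 ≤ p) (hq : 0 ≤ q) (h : q = 0 → p = 0) :
    (p - q) ^ 2 ≤ (2 * p + 4 * q) / 3 * (p * Real.log (p / q) - p + q) := by
  rcases hp.eq_or_lt with rfl | hp
  · nlinarith [sq_nonneg q]
  have hq : 0 < q := hq.lt_of_ne fun h0 => hp.ne' (h h0.symm)
  have hlog := mul_le_mul_of_nonneg_left (Real.rational_le_log (div_pos hp hq))
    (by positivity : 0 ≤ (2 * p + 4 * q) / 3 * p)
  have hrat : (2 * p + 4 * q) / 3 * p *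
      ((p / q - 1) * (5 * (p / q) + 1) / (2 * (p / q) * (p / q + 2)))
      = (p - q) ^ 2 - (2 * p + 4 * q) / 3 * (q - p) := by
    have hpq : p + 2 * q ≠ 0 := by positivity
    have hpq' : p + q * 2 ≠ 0 := by positivity
    field_simp
    ring
  rw [hrat] at hlog
  linarith

/-- **Pinsker's inequality** on a finite type. -/
theorem sq_sum_abs_sub_le_two_mul_sum_mul_log {A : Type*} [Fintype A] {p q : A → ℝ}
    (hp : ∀ a, 0 ≤ p a) (hq : ∀ a, 0 ≤ q a) (hp1 : ∑ a, p a = 1) (hq1 : ∑ a, q a = 1)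
    (hpq : ∀ a, q a = 0 → p a = 0) :
    (∑ a, |p a - q a|) ^ 2 ≤ 2 * ∑ a, p a * Real.log (p a / q a) := by
  have hpoint a := sq_sub_le_mul_log_div (hp a) (hq a) (hpq a)
  have hentropy : ∀ a, 0 ≤ p a * Real.log (p a / q a) - p a + q a := by
    intro a
    rcases (hp a).eq_or_lt with h0 | h0
    · simpa [← h0] using hq a
    · have hw : 0 < (2 * p a + 4 * q a) / 3 := by linarith [hq a]
      exact nonneg_of_mul_nonneg_right ((sq_nonneg _).trans (hpoint a)) hw
  have hcs := sum_sq_le_sum_mul_sum_of_sq_le_mul univ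
    (r := fun a => |p a - q a|) (f := fun a => (2 * p a + 4 * q a) / 3)
    (g := fun a => p a * Real.log (p a / q a) - p a + q a)
    (fun a _ => by linarith [hp a, hq a]) (fun a _ => hentropy a)
    (fun a _ => by rw [sq_abs]; exact hpoint a)
  have hweight : ∑ a, (2 * p a + 4 * q a) / 3 = 2 := by
    rw [← sum_div, sum_add_distrib, ← mul_sum, ← mul_sum, hp1, hq1]
    norm_num
  rw [hweight, sum_add_distrib, sum_sub_distrib, hp1, hq1] at hcs
  linarith

/-- Pinsker's inequality averaged over a distribution of states. -/
theorem sum_mul_sum_abs_sub_le_sqrt {S A : Type*} [Fintype S] [Fintype A]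
    {d : S → ℝ} {p q : S → A → ℝ} {κ : ℝ}
    (hd : ∀ s, 0 ≤ d s) (hd1 : ∑ s, d s = 1)
    (hp : ∀ s a, 0 ≤ p s a) (hq : ∀ s a, 0 ≤ q s a)
    (hp1 : ∀ s, ∑ a, p s a = 1) (hq1 : ∀ s, ∑ a, q s a = 1)
    (hpq : ∀ s a, q s a = 0 → p s a = 0)
    (hκ : ∑ s, d s * ∑ a, p s a * Real.log (p s a / q s a) ≤ κ) :
    ∑ s, d s * ∑ a, |p s a - q s a| ≤ √(2 * κ) := by
  refine Real.le_sqrt_of_sq_le ?_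
  calc (∑ s, d s * ∑ a, |p s a - q s a|) ^ 2
      ≤ (∑ s, d s) * ∑ s, d s * (∑ a, |p s a - q s a|) ^ 2 :=
        sum_sq_le_sum_mul_sum_of_sq_le_mul univ (fun s _ => hd s)
          (fun s _ => mul_nonneg (hd s) (sq_nonneg _)) (fun s _ => le_of_eq (by ring))
    _ ≤ ∑ s, d s * (2 * ∑ a, p s a * Real.log (p s a / q s a)) := by
        rw [hd1, one_mul]
        exact sum_le_sum fun s _ => mul_le_mul_of_nonneg_left
          (sq_sum_abs_sub_le_two_mul_sum_mul_log (hp s) (hq s) (hp1 s) (hq1 s) (hpq s)) (hd s)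
    _ = 2 * ∑ s, d s * ∑ a, p s a * Real.log (p s a / q s a) := by
        rw [mul_sum]
        exact sum_congr rfl fun s _ => by ring
    _ ≤ 2 * κ := by linarith

/-- The average-reward performance difference identity. The function `V` may be arbitrary. -/
theorem average_sub_eq_sum_mul_advantage {S A : Type*} [Fintype S] [Fintype A]
    {P g : S → A → S → ℝ} {p : S → A → ℝ} {d V : S → ℝ} {J : ℝ} {Q Adv : S → A → ℝ}
    (hP : ∀ s a, ∑ s', P s a s' = 1) (hp : ∀ s, ∑ a, p s a = 1) (hd : ∑ s, d s = 1)
    (hstat : ∀ s', ∑ s, d s * ∑ a, p s a * P s a s' = d s')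
    (hQ : ∀ s a, Q s a = ∑ s', P s a s' * (g s a s' - J + V s'))
    (hAdv : ∀ s a, Adv s a = Q s a - V s) :
    (∑ s, ∑ a, ∑ s', d s * p s a * P s a s' * g s a s') - J
      = ∑ s, d s * ∑ a, p s a * Adv s a := by
  have hQ' : ∀ s a, Q s a
      = ∑ s', P s a s' * g s a s' - J + ∑ s', P s a s' * V s' := by
    intro s a
    simp only [hQ, mul_add, mul_sub, sum_add_distrib, sum_sub_distrib, ← sum_mul, hP, one_mul]
  have hstate : ∀ s, ∑ a, p s a * Adv s a
      = ∑ a, p s a * ∑ s', P s a s' * g s a s' - J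
        + ∑ a, p s a * ∑ s', P s a s' * V s' - V s := by
    intro s
    simp only [hAdv, hQ', mul_add, mul_sub, sum_add_distrib, sum_sub_distrib, ← sum_mul, hp,
      one_mul]
  have hnext : ∑ s, d s * ∑ a, p s a * ∑ s', P s a s' * V s' = ∑ s, d s * V s := by
    calc ∑ s, d s * ∑ a, p s a * ∑ s', P s a s' * V s'
        = ∑ s, ∑ s', d s * (∑ a, p s a * P s a s') * V s' := by
          refine sum_congr rfl fun s _ => ?_
          simp only [mul_sum, sum_mul]
          rw [sum_comm]
          exact sum_congr rfl fun _ _ => sum_congr rfl fun _ _ => by ring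
      _ = ∑ s, d s * V s := by
          rw [sum_comm]
          exact sum_congr rfl fun s' _ => by rw [← sum_mul, hstat]
  have havg : ∑ s, ∑ a, ∑ s', d s * p s a * P s a s' * g s a s'
      = ∑ s, d s * ∑ a, p s a * ∑ s', P s a s' * g s a s' := by
    simp only [mul_sum, mul_assoc]
  simp only [hstate, mul_add, mul_sub, sum_add_distrib, sum_sub_distrib, ← sum_mul, hd, one_mul,
    hnext, havg]
  ring

/-- Changing the weights of a bounded function changes its weighted sum by at most the
`ℓ¹` distance of the weights times the bound. -/
theorem abs_sum_mul_sub_sum_mul_le_s5 {S : Type*} [Fintype S] {d d' f : S → ℝ} {M : ℝ}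
    (hf : ∀ s, |f s| ≤ M) :
    |∑ s, d' s * f s - ∑ s, d s * f s| ≤ (∑ s, |d' s - d s|) * M := by
  rw [← sum_sub_distrib, sum_mul]
  refine (abs_sum_le_sum_abs _ _).trans (sum_le_sum fun s _ => ?_)
  rw [← sub_mul, abs_mul]
  exact mul_le_mul_of_nonneg_left (hf s) (abs_nonneg _)


/-- **Worst-case performance degradation and constraint violation of the ACPO trust-region
update (Theorem 3.6 of ACPO).** If the trust-region subproblem is feasible at `π'` with
KL radius `δ + V_max`, then `J(π') − J ≥ −√(2(δ+V_max)) ν` and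
`J_{C_i}(π') ≤ l_i + √(2(δ+V_max)) ν_C` for all `i`. -/
theorem stmt_5
    {S A ι : Type*} [Fintype S] [Nonempty S] [Fintype A] [Fintype ι] [Nonempty ι]
    (P : S → A → S → ℝ) (r : S → A → S → ℝ) (C : ι → S → A → S → ℝ) (l : ι → ℝ)
    (pol pol' : S → A → ℝ) (d d' : S → ℝ)
    (J : ℝ) (V : S → ℝ) (Q Adv : S → A → ℝ)
    (JC : ι → ℝ) (VC : ι → S → ℝ) (QC AdvC : ι → S → A → ℝ)
    (σ δ Vmax : ℝ)
    (hP_nonneg : ∀ s a s', 0 ≤ P s a s')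
    (hP_sum : ∀ s a, ∑ s', P s a s' = 1)
    (hpol_nonneg : ∀ s a, 0 ≤ pol s a)
    (hpol_sum : ∀ s, ∑ a, pol s a = 1)
    (hpol'_nonneg : ∀ s a, 0 ≤ pol' s a)
    (hpol'_sum : ∀ s, ∑ a, pol' s a = 1)
    (hd_nonneg : ∀ s, 0 ≤ d s)
    (hd_sum : ∑ s, d s = 1)
    (hd_stat : ∀ s', ∑ s, d s * ∑ a, pol s a * P s a s' = d s')
    (hd'_nonneg : ∀ s, 0 ≤ d' s)
    (hd'_sum : ∑ s, d' s = 1)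
    (hd'_stat : ∀ s', ∑ s, d' s * ∑ a, pol' s a * P s a s' = d' s')
    (hQ : ∀ s a, Q s a = ∑ s', P s a s' * (r s a s' - J + V s'))
    (hPoisson : ∀ s, V s = ∑ a, pol s a * Q s a)
    (hAdv : ∀ s a, Adv s a = Q s a - V s)
    (hQC : ∀ i s a, QC i s a = ∑ s', P s a s' * (C i s a s' - JC i + VC i s'))
    (hPoissonC : ∀ i s, VC i s = ∑ a, pol s a * QC i s a)
    (hAdvC : ∀ i s a, AdvC i s a = QC i s a - VC i s)
    (hσ : 0 ≤ σ)
    (hsens : (1 / 2) * ∑ s, |d' s - d s|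
      ≤ σ * ∑ s, d s * ((1 / 2) * ∑ a, |pol' s a - pol s a|))
    (habs : ∀ s a, pol s a = 0 → pol' s a = 0)
    (hδ : 0 ≤ δ) (hVmax : 0 ≤ Vmax)
    (hKL : ∑ s, d s * ∑ a, pol' s a * Real.log (pol' s a / pol s a) ≤ δ + Vmax)
    (hfeas_obj : 0 ≤ ∑ s, d s * ∑ a, pol' s a * Adv s a)
    (hfeas_cost : ∀ i, JC i + ∑ s, d s * ∑ a, pol' s a * AdvC i s a ≤ l i) :
    ((∑ s, ∑ a, ∑ s', d' s * pol' s a * P s a s' * r s a s') - J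
      ≥ -Real.sqrt (2 * (δ + Vmax))
          * (σ * (Finset.univ.sup' Finset.univ_nonempty
              fun s => |∑ a, pol' s a * Adv s a|)))
    ∧ ∀ i, (∑ s, ∑ a, ∑ s', d' s * pol' s a * P s a s' * C i s a s')
        ≤ l i + Real.sqrt (2 * (δ + Vmax))
            * (σ * (Finset.univ.sup' Finset.univ_nonempty
                fun p : ι × S => |∑ a, pol' p.2 a * AdvC p.1 p.2 a|)) := by
  have hdist : ∑ s, |d' s - d s| ≤ σ * √(2 * (δ + Vmax)) := by
    have hpinsker := mul_le_mul_of_nonneg_left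
      (sum_mul_sum_abs_sub_le_sqrt hd_nonneg hd_sum hpol'_nonneg hpol_nonneg hpol'_sum hpol_sum
        habs hKL) hσ
    have hhalf : ∑ s, d s * ((1 / 2) * ∑ a, |pol' s a - pol s a|)
        = (1 / 2) * ∑ s, d s * ∑ a, |pol' s a - pol s a| := by
      rw [mul_sum]
      exact sum_congr rfl fun s _ => by ring
    rw [hhalf] at hsens
    linarith
  have hgap : ∀ (f : S → ℝ) (M : ℝ), (∀ s, |f s| ≤ M) →
      |∑ s, d' s * f s - ∑ s, d s * f s| ≤ √(2 * (δ + Vmax)) * (σ * M) := by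
    intro f M hf
    have hM : 0 ≤ M := (abs_nonneg _).trans (hf (Classical.arbitrary S))
    refine (abs_sum_mul_sub_sum_mul_le_s5 hf).trans
      ((mul_le_mul_of_nonneg_right hdist hM).trans (le_of_eq (by ring)))
  constructor
  · have h := hgap (fun s => ∑ a, pol' s a * Adv s a)
      (univ.sup' univ_nonempty fun s => |∑ a, pol' s a * Adv s a|)
      (fun s => le_sup' (fun s => |∑ a, pol' s a * Adv s a|) (mem_univ s))
    rw [average_sub_eq_sum_mul_advantage hP_sum hpol'_sum hd'_sum hd'_stat hQ hAdv]
    linarith [(abs_le.mp h).1]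
  · intro i
    have h := hgap (fun s => ∑ a, pol' s a * AdvC i s a)
      (univ.sup' univ_nonempty fun p : ι × S => |∑ a, pol' p.2 a * AdvC p.1 p.2 a|)
      (fun s => le_sup' (fun p : ι × S => |∑ a, pol' p.2 a * AdvC p.1 p.2 a|) (mem_univ (i, s)))
    have hdiff := average_sub_eq_sum_mul_advantage hP_sum hpol'_sum hd'_sum hd'_stat
      (hQC i) (hAdvC i)
    linarith [(abs_le.mp h).2, hfeas_cost i]
end

section
/- Let (S,A,P,r) be a finite Markov decision process with initial state distribution μ, and let π, π' be stationary policies. For γ ∈ (0,1), let V_γ^π be the unique solution of V(s) = Σ_a π(a|s) Σ_{s'} P(s'|s,a)(r(s,a,s') + γ V(s')), let Q_γ^π(s,a) = Σ_{s'} P(s'|s,a)(r(s,a,s') + γ V_γ^π(s')), A_γ^π = Q_γ^π − V_γ^π, let d_{π,γ}(s) = (1−γ) Σ_{t≥0} γ^t ℙ_μ^π(s_t = s) be the discounted occupation measure, and let ε^γ = max_{s} |Σ_a π'(a|s) A_γ^π(s,a)|. Suppose that, as γ → 1⁻, the quantity Σ_s d_{π,γ}(s) Σ_a π'(a|s) A_γ^π(s,a)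 converges to a finite limit, and ε^γ · Σ_s d_{π,γ}(s) TV(π'(·|s)‖π(·|s)) converges to a limit c > 0. Then lim_{γ→1⁻} [ Σ_s d_{π,γ}(s) Σ_a π'(a|s) A_γ^π(s,a) − (2γ ε^γ/(1−γ)) Σ_s d_{π,γ}(s) TV(π'(·|s)‖π(·|s)) ] = −∞; that is, the discounted policy-improvement lower bound of Achiam et al., multiplied by (1−γ), diverges to −∞ as the discount factor tends to one. -/
/-- **Trivialization of the discounted policy improvement bound as `γ → 1⁻`
(Lemma A.1 of ACPO).** The CPO lower bound, multiplied by `1 − γ`, diverges to `−∞`. -/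
theorem stmt_6
    {S A : Type*} [Fintype S] [Nonempty S] [Fintype A]
    (P : S → A → S → ℝ) (r : S → A → S → ℝ) (μ : S → ℝ)
    (pol pol' : S → A → ℝ)
    (prob : ℕ → S → ℝ)
    (V : ℝ → S → ℝ) (Q Adv : ℝ → S → A → ℝ)
    (d : ℝ → S → ℝ) (eps : ℝ → ℝ) (L c : ℝ)
    (hP_nonneg : ∀ s a s', 0 ≤ P s a s')
    (hP_sum : ∀ s a, ∑ s', P s a s' = 1)
    (hμ_nonneg : ∀ s, 0 ≤ μ s) (hμ_sum : ∑ s, μ s = 1)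
    (hpol_nonneg : ∀ s a, 0 ≤ pol s a) (hpol_sum : ∀ s, ∑ a, pol s a = 1)
    (hpol'_nonneg : ∀ s a, 0 ≤ pol' s a) (hpol'_sum : ∀ s, ∑ a, pol' s a = 1)
    (hprob_zero : ∀ s, prob 0 s = μ s)
    (hprob_succ : ∀ t s', prob (t + 1) s' = ∑ s, prob t s * ∑ a, pol s a * P s a s')
    (hV : ∀ γ ∈ Set.Ioo (0 : ℝ) 1, ∀ s,
      V γ s = ∑ a, pol s a * ∑ s', P s a s' * (r s a s' + γ * V γ s'))
    (hQ : ∀ γ ∈ Set.Ioo (0 : ℝ) 1, ∀ s a,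
      Q γ s a = ∑ s', P s a s' * (r s a s' + γ * V γ s'))
    (hAdv : ∀ γ s a, Adv γ s a = Q γ s a - V γ s)
    (hd : ∀ γ ∈ Set.Ioo (0 : ℝ) 1, ∀ s,
      d γ s = (1 - γ) * ∑' t : ℕ, γ ^ t * prob t s)
    (heps : ∀ γ, eps γ = Finset.univ.sup' Finset.univ_nonempty
      fun s => |∑ a, pol' s a * Adv γ s a|)
    (hlim_surr : Filter.Tendsto (fun γ => ∑ s, d γ s * ∑ a, pol' s a * Adv γ s a)
      (nhdsWithin 1 (Set.Iio 1)) (nhds L))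
    (hlim_pen : Filter.Tendsto
      (fun γ => eps γ * ∑ s, d γ s * ((1 / 2) * ∑ a, |pol' s a - pol s a|))
      (nhdsWithin 1 (Set.Iio 1)) (nhds c))
    (hc : 0 < c) :
    Filter.Tendsto
      (fun γ => (∑ s, d γ s * ∑ a, pol' s a * Adv γ s a)
        - (2 * γ * eps γ / (1 - γ))
            * ∑ s, d γ s * ((1 / 2) * ∑ a, |pol' s a - pol s a|))
      (nhdsWithin 1 (Set.Iio 1)) Filter.atBot := by
  have hgap : Filter.Tendsto (fun γ : ℝ => 1 - γ)
      (nhdsWithin 1 (Set.Iio 1)) (nhdsWithin 0 (Set.Ioi 0)) := by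
    refine tendsto_nhdsWithin_iff.2 ⟨?_, ?_⟩
    · have h : Filter.Tendsto (fun γ : ℝ => 1 - γ) (nhds 1) (nhds (1 - 1)) :=
        tendsto_const_nhds.sub Filter.tendsto_id
      rw [sub_self] at h
      exact h.mono_left nhdsWithin_le_nhds
    · filter_upwards [self_mem_nhdsWithin] with γ hγ
      exact sub_pos.2 (Set.mem_Iio.1 hγ)
  have hfactor : Filter.Tendsto (fun γ : ℝ => 2 * γ)
      (nhdsWithin 1 (Set.Iio 1)) (nhds (2 * 1)) :=
    (tendsto_const_nhds.mul Filter.tendsto_id).mono_left nhdsWithin_le_nhds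
  have hpenalty := (hfactor.mul hlim_pen).pos_mul_atTop (by positivity)
    (tendsto_inv_nhdsGT_zero.comp hgap)
  refine (hlim_surr.add_atBot (Filter.tendsto_neg_atTop_atBot.comp hpenalty)).congr fun γ => ?_
  simp only [Function.comp_apply]
  ring
end

section
/- Consider a finite-horizon Markov decision process with finite state space S, finite action space A, horizon H, transition kernel P, reward r : S × A × S → ℝ, and initial state distribution μ. For any two (non-stationary) policies π = (π_1,…,π_H) and π' = (π'_1,…,π'_H), define value functions backward by V^π_{H+1} ≡ 0, Q^π_h(s,a) = Σ_{s'} P(s'|s,a)(r(s,a,s') + V^π_{h+1}(s')), V^π_h(s) = Σ_a π_h(a|s) Q^π_h(s,a), and advantages A^π_h = Q^π_h − V^π_h; let J(π) = Σ_s μ(s) V^π_1(s), and let ℙ^π_h(s,a) denote the probability that (s_h, a_h) = (s,a) when s_1 ∼ μ, a_t ∼ π_t(·|s_t) and s_{t+1} ∼ P(·|s_t,a_t). Then J(π) − J(π') = Σ_{h=1}^{H} Σ_{(s,a)∈S×A} ℙ^π_h(s,a) · A^{π'}_h(s,a). -/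
/-- One-step form of the policy difference identity: the gap in value under a state distribution `ρ`
is the expected advantage plus the gap in continuation value under the next-state distribution. -/
theorem value_gap_eq_advantage_add_next_gap
    {S A : Type*} [Fintype S] [Fintype A]
    (P r : S → A → S → ℝ) (ρ v' w w' : S → ℝ) (p q q' : S → A → ℝ)
    (hp : ∀ s, ∑ a, p s a = 1)
    (hq : ∀ s a, q s a = ∑ s', P s a s' * (r s a s' + w s'))
    (hq' : ∀ s a, q' s a = ∑ s', P s a s' * (r s a s' + w' s')) :
    ∑ s, ρ s * (∑ a, p s a * q s a - v' s)
      = ∑ s, ∑ a, ρ s * p s a * (q' s a - v' s)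
        + ∑ s', (∑ s, ∑ a, ρ s * p s a * P s a s') * (w s' - w' s') := by
  have hgap : ∀ s a, q s a = q' s a + ∑ s', P s a s' * (w s' - w' s') := by
    intro s a
    rw [hq, hq', ← Finset.sum_add_distrib]
    exact Finset.sum_congr rfl fun s' _ => by ring
  have hnext : ∑ s', (∑ s, ∑ a, ρ s * p s a * P s a s') * (w s' - w' s')
      = ∑ s, ∑ a, ρ s * p s a * ∑ s', P s a s' * (w s' - w' s') := by
    simp_rw [Finset.sum_mul, Finset.mul_sum]
    rw [Finset.sum_comm]
    refine Finset.sum_congr rfl fun s _ => ?_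
    rw [Finset.sum_comm]
    exact Finset.sum_congr rfl fun a _ => Finset.sum_congr rfl fun s' _ => by ring
  rw [hnext, ← Finset.sum_add_distrib]
  refine Finset.sum_congr rfl fun s _ => ?_
  have hv : v' s = ∑ a, p s a * v' s := by rw [← Finset.sum_mul, hp, one_mul]
  rw [hv, ← Finset.sum_sub_distrib, Finset.mul_sum, ← Finset.sum_add_distrib, ← hv]
  exact Finset.sum_congr rfl fun a _ => by rw [hgap]; ring

/-- **Policy difference lemma for episodic (finite-horizon) MDPs (Lemma 3.1 of e-COP).**
`J(π) − J(π') = Σ_{h=1}^H Σ_{(s,a)} ℙ^π_h(s,a) A^{π'}_h(s,a)`. -/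
theorem stmt_9
    {S A : Type*} [Fintype S] [Fintype A]
    (H : ℕ) (P : S → A → S → ℝ) (r : S → A → S → ℝ) (μ : S → ℝ)
    (pol pol' : ℕ → S → A → ℝ)
    (V V' : ℕ → S → ℝ) (Q Q' Adv' : ℕ → S → A → ℝ)
    (occ : ℕ → S → A → ℝ)
    (hP_nonneg : ∀ s a s', 0 ≤ P s a s')
    (hP_sum : ∀ s a, ∑ s', P s a s' = 1)
    (hμ_nonneg : ∀ s, 0 ≤ μ s) (hμ_sum : ∑ s, μ s = 1)
    (hpol_nonneg : ∀ h ∈ Finset.Icc 1 H, ∀ s a, 0 ≤ pol h s a)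
    (hpol_sum : ∀ h ∈ Finset.Icc 1 H, ∀ s, ∑ a, pol h s a = 1)
    (hpol'_nonneg : ∀ h ∈ Finset.Icc 1 H, ∀ s a, 0 ≤ pol' h s a)
    (hpol'_sum : ∀ h ∈ Finset.Icc 1 H, ∀ s, ∑ a, pol' h s a = 1)
    (hQ : ∀ h ∈ Finset.Icc 1 H, ∀ s a,
      Q h s a = ∑ s', P s a s' * (r s a s' + V (h + 1) s'))
    (hV : ∀ h ∈ Finset.Icc 1 H, ∀ s, V h s = ∑ a, pol h s a * Q h s a)
    (hV_top : ∀ s, V (H + 1) s = 0)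
    (hQ' : ∀ h ∈ Finset.Icc 1 H, ∀ s a,
      Q' h s a = ∑ s', P s a s' * (r s a s' + V' (h + 1) s'))
    (hV' : ∀ h ∈ Finset.Icc 1 H, ∀ s, V' h s = ∑ a, pol' h s a * Q' h s a)
    (hV'_top : ∀ s, V' (H + 1) s = 0)
    (hAdv' : ∀ h s a, Adv' h s a = Q' h s a - V' h s)
    (hocc_one : ∀ s a, occ 1 s a = μ s * pol 1 s a)
    (hocc_succ : ∀ h, 1 ≤ h → h + 1 ≤ H → ∀ s' a',
      occ (h + 1) s' a' = (∑ s, ∑ a, occ h s a * P s a s') * pol (h + 1) s' a') :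
    (∑ s, μ s * V 1 s) - (∑ s, μ s * V' 1 s)
      = ∑ h ∈ Finset.Icc 1 H, ∑ s, ∑ a, occ h s a * Adv' h s a := by
  let ρ : ℕ → S → ℝ := fun h s' =>
    if h = 1 then μ s' else ∑ s, ∑ a, occ (h - 1) s a * P s a s'
  have hocc : ∀ h ∈ Finset.Icc 1 H, ∀ s a, occ h s a = ρ h s * pol h s a := by
    intro h hh s a
    obtain ⟨h1, hH⟩ := Finset.mem_Icc.mp hh
    obtain rfl | hne := eq_or_ne h 1
    · simp [ρ, hocc_one]
    · obtain ⟨k, rfl⟩ : ∃ k, h = k + 1 := ⟨h - 1, by omega⟩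
      rw [hocc_succ k (by omega) hH]
      simp only [ρ, if_neg hne, Nat.add_sub_cancel]
  let g : ℕ → ℝ := fun h => ∑ s, ρ h s * (V h s - V' h s)
  have hstep : ∀ h ∈ Finset.Icc 1 H,
      ∑ s, ∑ a, occ h s a * Adv' h s a = g h - g (h + 1) := by
    intro h hh
    have hne : h + 1 ≠ 1 := by have := Finset.mem_Icc.mp hh; omega
    have key := value_gap_eq_advantage_add_next_gap P r (ρ h) (V' h) (V (h + 1)) (V' (h + 1))
      (pol h) (Q h) (Q' h) (hpol_sum h hh) (hQ h hh) (hQ' h hh)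
    simp only [← hocc h hh, ← hV h hh, ← hAdv'] at key
    simp only [g]
    rw [key]
    simp only [ρ, if_neg hne, Nat.add_sub_cancel, add_sub_cancel_right]
  have htel : ∀ n : ℕ, ∑ h ∈ Finset.Icc 1 n, (g h - g (h + 1)) = g 1 - g (n + 1) := by
    intro n
    induction n with
    | zero => simp
    | succ n ih => rw [Finset.sum_Icc_succ_top (by omega), ih]; ring
  have hg_one : g 1 = ∑ s, μ s * V 1 s - ∑ s, μ s * V' 1 s := by
    simp [g, ρ, mul_sub]
  have hg_top : g (H + 1) = 0 := by simp [g, hV_top, hV'_top]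
  rw [Finset.sum_congr rfl hstep, htel, hg_one, hg_top, sub_zero]
end

section
/- Let f : [0,∞) → ℝ be convex and differentiable with f(1) = 0 (so that f generates an f-divergence and is not a barrier function). Then for every C > 0, every integer N ≥ 4 and every integer K ≥ 2, taking Y to be a set of N elements, the following holds: for every function 𝒜 that maps a (K+1)-tuple of probability distributions on Y together with a weight vector w in the simplex Δ^{K−1} to a probability distribution on Y, there exist a full-support probability distribution π_ref on Y, probability distributions π_1,…,π_K and π' on Y, reward functions R_1,…,R_K : Y → ℝ, a weight vector w ∈ Δ^{K−1}, and τ > 0, such that for every i ∈ {1,…,K} the distribution π_i maximizes π ↦ Σ_y π(y) R_i(y) − τ · I_f(π‖π_ref) over all probability distributions π on Y, and yet, writing π_𝒜 = 𝒜(π_ref, π_1,…,π_K, w): (1) Σ_y π_𝒜(y) Σ_i w_i R_i(y) ≤ Σ_y π'(y) Σ_i w_i R_i(y) − C, and (2) Σ_y π_𝒜(y) Σ_i w_i R_i(y) − τ I_f(π_𝒜‖π_ref) ≤ Σ_y π'(y) Σ_i w_i R_i(y) − τ I_f(π'‖π_ref) − C. -/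
/-- A convex function lies above its tangent line at every point of differentiability. -/
theorem ConvexOn.add_mul_sub_le_of_hasDerivWithinAt {S : Set ℝ} {f : ℝ → ℝ} {x y d : ℝ}
    (hf : ConvexOn ℝ S f) (hx : x ∈ S) (hy : y ∈ S) (hd : HasDerivWithinAt f d S x) :
    f x + d * (y - x) ≤ f y := by
  rcases lt_trichotomy x y with h | rfl | h
  · have := hf.le_slope_of_hasDerivWithinAt hx hy h hd
    rw [slope_def_field, le_div_iff₀ (sub_pos.2 h)] at this
    linarith
  · simp
  · have := hf.slope_le_of_hasDerivWithinAt hy hx h hd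
    rw [slope_def_field, div_le_iff₀ (sub_pos.2 h)] at this
    linarith

/-- For a convex `f` differentiable on `[0, ∞)`, moving mass away from a point mass decreases
the `f`-divergence from a uniform reference at most linearly in the mass moved. -/
theorem exists_sum_single_le_sum_add {ι : Type*} [Fintype ι] [DecidableEq ι] {f : ℝ → ℝ}
    (hconv : ConvexOn ℝ (Set.Ici 0) f) (hdiff : DifferentiableOn ℝ f (Set.Ici 0))
    {u : ℝ} (hu : 0 < u) :
    ∃ c : ℝ, 0 ≤ c ∧ ∀ (a : ι) (p : ι → ℝ), (∀ y, 0 ≤ p y) → ∑ y, p y = 1 → p a ≤ 1 →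
      ∑ y, u * f ((Pi.single a 1 : ι → ℝ) y / u) ≤ ∑ y, u * f (p y / u) + c * (1 - p a) := by
  obtain ⟨s, hs⟩ : ∃ s, HasDerivWithinAt f s (Set.Ici 0) 0 :=
    ⟨_, (hdiff 0 Set.self_mem_Ici).hasDerivWithinAt⟩
  have hu' : 1 / u ∈ Set.Ici (0 : ℝ) := by simpa using hu.le
  obtain ⟨t, ht⟩ : ∃ t, HasDerivWithinAt f t (Set.Ici 0) (1 / u) :=
    ⟨_, (hdiff _ hu').hasDerivWithinAt⟩
  refine ⟨|t - s|, abs_nonneg _, fun a p hp hp1 hpa ↦ ?_⟩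
  calc ∑ y, u * f ((Pi.single a 1 : ι → ℝ) y / u)
      ≤ ∑ y, (u * f (p y / u) - s * p y
          + (Pi.single a (t * (1 - p a) + s * p a) : ι → ℝ) y) := by
        refine Finset.sum_le_sum fun y _ ↦ ?_
        have hy : p y / u ∈ Set.Ici (0 : ℝ) := div_nonneg (hp y) hu.le
        rcases eq_or_ne y a with rfl | hya
        · have h := mul_le_mul_of_nonneg_left
            (hconv.add_mul_sub_le_of_hasDerivWithinAt hu' hy ht) hu.le
          have e : u * (f (1 / u) + t * (p y / u - 1 / u)) = u * f (1 / u) + t * (p y - 1) := by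
            field_simp
          rw [e] at h
          simp only [Pi.single_eq_same]
          linarith
        · have h := mul_le_mul_of_nonneg_left
            (hconv.add_mul_sub_le_of_hasDerivWithinAt Set.self_mem_Ici hy hs) hu.le
          have e : u * (f 0 + s * (p y / u - 0)) = u * f 0 + s * p y := by
            field_simp
            ring
          rw [e] at h
          simp only [Pi.single_eq_of_ne hya, zero_div]
          linarith
    _ = ∑ y, u * f (p y / u) + (t - s) * (1 - p a) := by
        rw [Finset.sum_add_distrib, Finset.sum_sub_distrib, ← Finset.mul_sum _ p, hp1,
          Finset.sum_pi_single']
        simp only [Finset.mem_univ, if_true]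
        ring
    _ ≤ ∑ y, u * f (p y / u) + |t - s| * (1 - p a) := by
        have : 0 ≤ 1 - p a := sub_nonneg.2 hpa
        gcongr
        exact le_abs_self _

/-- An expectation is bounded by its value at `a` and an upper bound on the values elsewhere. -/
theorem sum_mul_le_of_forall_ne {ι : Type*} [Fintype ι] [DecidableEq ι] {p R : ι → ℝ} {a : ι}
    {r : ℝ} (hp : ∀ y, 0 ≤ p y) (hp1 : ∑ y, p y = 1) (hR : ∀ y, y ≠ a → R y ≤ r) :
    ∑ y, p y * R y ≤ r * (1 - p a) + p a * R a := by
  calc ∑ y, p y * R y ≤ ∑ y, (r * p y + (Pi.single a (p a * (R a - r)) : ι → ℝ) y) := by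
        refine Finset.sum_le_sum fun y _ ↦ ?_
        rcases eq_or_ne y a with rfl | hya
        · simp only [Pi.single_eq_same]
          linarith
        · have := mul_le_mul_of_nonneg_left (hR y hya) (hp y)
          simp only [Pi.single_eq_of_ne hya]
          linarith
    _ = r * (1 - p a) + p a * R a := by
        rw [Finset.sum_add_distrib, ← Finset.mul_sum, hp1, Finset.sum_pi_single']
        simp only [Finset.mem_univ, if_true]
        ring


/-- **No multi-objective decoding/merging algorithm is optimal when `f` is not a barrier
function (Theorem of MOPO appendix).** -/
theorem stmt_17
    (f : ℝ → ℝ)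
    (hconv : ConvexOn ℝ (Set.Ici 0) f)
    (hdiff : DifferentiableOn ℝ f (Set.Ici 0))
    (hf1 : f 1 = 0)
    (C : ℝ) (hC : 0 < C) (N : ℕ) (hN : 4 ≤ N) (K : ℕ) (hK : 2 ≤ K)
    (Alg : (Fin N → ℝ) → (Fin K → Fin N → ℝ) → (Fin K → ℝ) → (Fin N → ℝ))
    (hAlg : ∀ (pref : Fin N → ℝ) (pols : Fin K → Fin N → ℝ) (w : Fin K → ℝ),
      (∀ y, 0 < pref y) → (∑ y, pref y = 1) →
      (∀ i, (∀ y, 0 ≤ pols i y) ∧ ∑ y, pols i y = 1) →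
      (∀ i, 0 ≤ w i) → (∑ i, w i = 1) →
      (∀ y, 0 ≤ Alg pref pols w y) ∧ ∑ y, Alg pref pols w y = 1) :
    ∃ (pref : Fin N → ℝ) (pols : Fin K → Fin N → ℝ) (pi' : Fin N → ℝ)
      (R : Fin K → Fin N → ℝ) (w : Fin K → ℝ) (τ : ℝ),
      (∀ y, 0 < pref y) ∧ (∑ y, pref y = 1) ∧
      (∀ i, (∀ y, 0 ≤ pols i y) ∧ ∑ y, pols i y = 1) ∧
      (∀ y, 0 ≤ pi' y) ∧ (∑ y, pi' y = 1) ∧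
      (∀ i, 0 ≤ w i) ∧ (∑ i, w i = 1) ∧ 0 < τ ∧
      (∀ i : Fin K, ∀ pp : Fin N → ℝ, (∀ y, 0 ≤ pp y) → (∑ y, pp y = 1) →
        (∑ y, pp y * R i y) - τ * ∑ y, pref y * f (pp y / pref y)
          ≤ (∑ y, pols i y * R i y) - τ * ∑ y, pref y * f (pols i y / pref y)) ∧
      (∑ y, Alg pref pols w y * ∑ i, w i * R i y
        ≤ (∑ y, pi' y * ∑ i, w i * R i y) - C) ∧
      ((∑ y, Alg pref pols w y * ∑ i, w i * R i y)
          - τ * ∑ y, pref y * f (Alg pref pols w y / pref y)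
        ≤ (∑ y, pi' y * ∑ i, w i * R i y)
          - τ * ∑ y, pref y * f (pi' y / pref y) - C) := by
  have hN0 : 0 < (N : ℝ) := by
    have : 0 < N := by omega
    exact_mod_cast this
  obtain ⟨c, hc, hdiv⟩ := exists_sum_single_le_sum_add (ι := Fin N) hconv hdiff (inv_pos.2 hN0)
  have hsingle : ∀ a : Fin N, (∀ y, 0 ≤ (Pi.single a 1 : Fin N → ℝ) y) ∧
      ∑ y, (Pi.single a 1 : Fin N → ℝ) y = 1 := fun a ↦
    ⟨fun y ↦ (Pi.single_nonneg.2 zero_le_one : (0 : Fin N → ℝ) ≤ Pi.single a 1) y, by simp⟩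
  have hval : ∀ (a : Fin N) (r : Fin N → ℝ), ∑ y, (Pi.single a 1 : Fin N → ℝ) y * r y = r a :=
    fun a r ↦ by simp [Pi.single_apply]
  let k₀ : Fin K := ⟨0, by omega⟩
  let k₁ : Fin K := ⟨1, by omega⟩
  have hk : k₀ ≠ k₁ := by simp [k₀, k₁]
  let y₀ : Fin N := ⟨0, by omega⟩
  let y₁ : Fin N := ⟨1, by omega⟩
  let y₂ : Fin N := ⟨2, by omega⟩
  let y₃ : Fin N := ⟨3, by omega⟩
  let a : Fin K → Fin N := fun i ↦ if i = k₀ then y₀ else y₁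
  let pref : Fin N → ℝ := fun _ ↦ (N : ℝ)⁻¹
  let pols : Fin K → Fin N → ℝ := fun i ↦ Pi.single (a i) 1
  let w : Fin K → ℝ := Pi.single k₀ (1 / 2) + Pi.single k₁ (1 / 2)
  have hw0 : ∀ i, 0 ≤ w i := fun i ↦ by
    simp only [w, Pi.add_apply, Pi.single_apply]
    positivity
  have hwsum : ∀ r : Fin K → ℝ, ∑ i, w i * r i = r k₀ / 2 + r k₁ / 2 := fun r ↦ by
    simp only [w, Pi.add_apply, Pi.single_apply, add_mul, Finset.sum_add_distrib, ite_mul,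
      zero_mul, Finset.sum_ite_eq', Finset.mem_univ, if_true]
    ring
  have hw1 : ∑ i, w i = 1 := by
    have := hwsum fun _ ↦ 1
    simp only [mul_one] at this
    rw [this]
    norm_num
  have hpref : ∀ y, 0 < pref y := fun _ ↦ inv_pos.2 hN0
  have hpref1 : ∑ y, pref y = 1 := by simp [pref, hN0.ne']
  have hpols : ∀ i, (∀ y, 0 ≤ pols i y) ∧ ∑ y, pols i y = 1 := fun i ↦ hsingle (a i)
  obtain ⟨hq0, hq1⟩ := hAlg pref pols w hpref hpref1 hpols hw0 hw1
  set q := Alg pref pols w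
  have hle : ∀ p : Fin N → ℝ, (∀ y, 0 ≤ p y) → ∑ y, p y = 1 → ∀ y, p y ≤ 1 := fun p h0 h1 y ↦
    h1 ▸ Finset.single_le_sum (fun i _ ↦ h0 i) (Finset.mem_univ y)
  obtain ⟨z, hz₀, hz₁, hqz⟩ : ∃ z, z ≠ y₀ ∧ z ≠ y₁ ∧ q z ≤ 1 / 2 := by
    by_cases h : q y₂ ≤ 1 / 2
    · exact ⟨y₂, by simp [y₂, y₀], by simp [y₂, y₁], h⟩
    · refine ⟨y₃, by simp [y₃, y₀], by simp [y₃, y₁], ?_⟩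
      have h23 : y₂ ≠ y₃ := by simp [y₂, y₃]
      have := Finset.sum_le_sum_of_subset_of_nonneg (Finset.subset_univ {y₂, y₃})
        fun i _ _ ↦ hq0 i
      rw [Finset.sum_pair h23, hq1] at this
      linarith
  let R : Fin K → Fin N → ℝ := fun i y ↦
    if y = a i then 0 else if y = z then -c else -(4 * C + 4 * c)
  have hza : ∀ i, z ≠ a i := fun i ↦ by
    simp only [a]
    split_ifs <;> assumption
  have hRz : ∑ i, w i * R i z = -c := by
    rw [hwsum]
    simp only [R, if_neg (hza _), if_true]
    ring
  have hR : ∀ y, y ≠ z → ∑ i, w i * R i y ≤ -(2 * C + 2 * c) := fun y hy ↦ by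
    have h01 : y₀ ≠ y₁ := by simp [y₀, y₁]
    rw [hwsum]
    simp only [R, a, if_neg hy, if_true, if_neg hk.symm]
    split_ifs with h h'
    · exact absurd (h.symm.trans h') h01
    all_goals linarith
  have hgain := sum_mul_le_of_forall_ne hq0 hq1 hR
  have hdivz := hdiv z q hq0 hq1 (hle q hq0 hq1 z)
  have hvalz := hval z fun y ↦ ∑ i, w i * R i y
  have hmargin : C * (1 / 2) ≤ C * (1 - q z) := by
    gcongr
    linarith
  have hcq : 0 ≤ c * (1 - q z) := mul_nonneg hc (by linarith)
  rw [hRz] at hgain hvalz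
  refine ⟨pref, pols, Pi.single z 1, R, w, 1, hpref, hpref1, hpols, (hsingle z).1, (hsingle z).2,
    hw0, hw1, one_pos, fun i p hp hp1 ↦ ?_, ?_, ?_⟩
  · have hRi : ∀ y, y ≠ a i → R i y ≤ -c := fun y hy ↦ by
      simp only [R, if_neg hy]
      split_ifs <;> linarith
    have h := sum_mul_le_of_forall_ne hp hp1 hRi
    have hd := hdiv (a i) p hp hp1 (hle p hp hp1 _)
    have hRa : R i (a i) = 0 := by simp [R]
    simp only [pols, pref, hval, hRa, one_mul] at h ⊢
    linarith
  · rw [hvalz]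
    linarith
  · rw [hvalz]
    simp only [pref, one_mul]
    linarith
end

section
/- Let B_{σ,s} : ℝ → ℝ be the relaxed logarithmic barrier, B_{σ,s}(z) = −σ · log(−z) for z ≤ −s and B_{σ,s}(z) = (σ/s) z + (1 − log s) σ for z > −s, and take s = σ². Then, as σ → 0⁺, B_{σ,σ²}(z) converges pointwise to the characteristic function χ{z ≤ 0}: for every z ≤ 0, lim_{σ→0⁺} B_{σ,σ²}(z) = 0, and for every z > 0, B_{σ,σ²}(z) → +∞ as σ → 0⁺. -/
/-- The relaxed logarithmic barrier with parameters `σ, s > 0`. -/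
noncomputable def relaxedLogBarrier (σ s z : ℝ) : ℝ :=
  if z ≤ -s then -σ * Real.log (-z) else (σ / s) * z + (1 - Real.log s) * σ

/-- The constant term of the linear extension vanishes as `σ → 0` when `s = σ²`. -/
theorem tendsto_one_sub_log_sq_mul :
    Filter.Tendsto (fun σ : ℝ => (1 - Real.log (σ ^ 2)) * σ)
      (nhdsWithin 0 (Set.Ioi 0)) (nhds 0) := by
  have hcont : Continuous fun σ : ℝ => σ - 2 * (σ * Real.log σ) :=
    continuous_id.sub (continuous_const.mul Real.continuous_mul_log)
  have hlim : Filter.Tendsto (fun σ : ℝ => σ - 2 * (σ * Real.log σ))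
      (nhdsWithin 0 (Set.Ioi 0)) (nhds 0) :=
    (hcont.tendsto' 0 0 (by simp)).mono_left nhdsWithin_le_nhds
  refine hlim.congr fun σ => ?_
  rw [Real.log_pow]
  push_cast
  ring

/-- **Convergence of the relaxed logarithmic barrier to the characteristic function
`χ{z ≤ 0}` as `σ → 0⁺` with `s = σ²`.** -/
theorem stmt_19 (z : ℝ) :
    (z ≤ 0 → Filter.Tendsto (fun σ : ℝ => relaxedLogBarrier σ (σ ^ 2) z)
      (nhdsWithin 0 (Set.Ioi 0)) (nhds 0)) ∧
    (0 < z → Filter.Tendsto (fun σ : ℝ => relaxedLogBarrier σ (σ ^ 2) z)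
      (nhdsWithin 0 (Set.Ioi 0)) Filter.atTop) := by
  constructor
  · intro hz
    rcases hz.lt_or_eq with hz | rfl
    · have hlim : Filter.Tendsto (fun σ : ℝ => -σ * Real.log (-z))
          (nhdsWithin 0 (Set.Ioi 0)) (nhds 0) :=
        ((continuous_neg.mul continuous_const).tendsto' 0 0 (by simp)).mono_left
          nhdsWithin_le_nhds
      have hsq : Filter.Tendsto (fun σ : ℝ => σ ^ 2) (nhdsWithin 0 (Set.Ioi 0)) (nhds 0) :=
        ((continuous_pow 2).tendsto' 0 0 (by simp)).mono_left nhdsWithin_le_nhds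
      refine hlim.congr' ?_
      filter_upwards [hsq.eventually_lt_const (neg_pos.mpr hz)] with σ hσ
      rw [relaxedLogBarrier, if_pos (by linarith)]
    · refine tendsto_one_sub_log_sq_mul.congr' ?_
      filter_upwards [self_mem_nhdsWithin] with σ hσ
      have hσ2 : 0 < σ ^ 2 := pow_pos hσ 2
      rw [relaxedLogBarrier, if_neg (by linarith), mul_zero, zero_add]
  · intro hz
    refine ((tendsto_inv_nhdsGT_zero.atTop_mul_const hz).atTop_add
      tendsto_one_sub_log_sq_mul).congr' ?_
    filter_upwards [self_mem_nhdsWithin] with σ hσ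
    have hσ0 : σ ≠ 0 := ne_of_gt hσ
    have hdiv : σ / σ ^ 2 = σ⁻¹ := by field_simp
    rw [relaxedLogBarrier, if_neg (by nlinarith [sq_nonneg σ]), hdiv]
end
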